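/- arXiv:math/9407220 — 4 statements merged into one kernel-verified Lean document; each statement's English description precedes it below -/
import Mathlib

section
/- Suppose n ≥ 1 and a, b, c are nonzero integers with a^n + b^n = c^n. Then the Weierstrass curve over ℚ defined by y² = x(x + a^n)(x - b^n) (i.e., with coefficients a₁ = 0, a₂ = a^n - b^n, a₃ = 0, a₄ = -a^n b^n, a₆ = 0) has nonzero discriminant, hence is an elliptic curve. -/
/-- If `n ≥ 1` and `a`, `b`, `c` are nonzero integers with `a^n + b^n = c^n`, then the
Weierstrass curve `y² = x(x + aⁿ)(x - bⁿ)` over `ℚ` has nonzero discriminant, hence is an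
elliptic curve. -/
theorem frey_curve_discriminant_ne_zero (n : ℕ) (hn : 1 ≤ n) (a b c : ℤ)
    (ha : a ≠ 0) (hb : b ≠ 0) (hc : c ≠ 0) (h : a ^ n + b ^ n = c ^ n) :
    (⟨0, (a : ℚ) ^ n - (b : ℚ) ^ n, 0, -((a : ℚ) ^ n * (b : ℚ) ^ n), 0⟩ :
      WeierstrassCurve ℚ).Δ ≠ 0 := by
  have hA : (a : ℚ) ^ n ≠ 0 := pow_ne_zero _ (Int.cast_ne_zero.mpr ha)
  have hB : (b : ℚ) ^ n ≠ 0 := pow_ne_zero _ (Int.cast_ne_zero.mpr hb)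
  have hC : (a : ℚ) ^ n + (b : ℚ) ^ n ≠ 0 := by
    have h' : (a : ℚ) ^ n + (b : ℚ) ^ n = (c : ℚ) ^ n := by exact_mod_cast h
    rw [h']
    exact pow_ne_zero _ (Int.cast_ne_zero.mpr hc)
  generalize (a : ℚ) ^ n = A at *
  generalize (b : ℚ) ^ n = B at *
  have key : (⟨0, A - B, 0, -(A * B), 0⟩ : WeierstrassCurve ℚ).Δ
      = 16 * (A * B * (A + B)) ^ 2 := by
    simp only [WeierstrassCurve.Δ, WeierstrassCurve.b₂, WeierstrassCurve.b₄,
      WeierstrassCurve.b₆, WeierstrassCurve.b₈]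
    ring
  rw [key]
  exact mul_ne_zero (by norm_num) (pow_ne_zero _ (mul_ne_zero (mul_ne_zero hA hB) hC))
end

section
/- Let k be a field of characteristic different from 2, let G be a group, and let ρ : G → GL₂(k) be a group homomorphism such that the associated representation of G on k² is irreducible (the corresponding k[G]-module is simple). Suppose there exists τ ∈ G with ρ(τ)² = 1 and det(ρ(τ)) = -1. Then ρ is absolutely irreducible: the representation of G on k̄² obtained by extending scalars to an algebraic closure k̄ of k is irreducible. -/
open Matrix

lemma exists_rational_vec {k K : Type*} [Field k] [Field K] [Algebra k K]
    (M : Matrix (Fin 2) (Fin 2) k) (hM : M.det = 0) (W : Submodule K (Fin 2 → K))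
    (w : Fin 2 → K) (hw : (M.map (algebraMap k K)).mulVec w ∈ W)
    (h0 : (M.map (algebraMap k K)).mulVec w ≠ 0) :
    ∃ u : Fin 2 → k, u ≠ 0 ∧ (fun i => algebraMap k K (u i)) ∈ W := by
  obtain ⟨x, hx, hxM⟩ := Matrix.exists_vecMul_eq_zero_iff.2 hM
  set y := (M.map (algebraMap k K)).mulVec w with hy
  have key : algebraMap k K (x 0) * y 0 + algebraMap k K (x 1) * y 1 = 0 := by
    have h1 := congrArg (algebraMap k K) (congrFun hxM 0)
    have h2 := congrArg (algebraMap k K) (congrFun hxM 1)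
    simp [Matrix.vecMul, dotProduct, Fin.sum_univ_two] at h1 h2
    simp [hy]
    linear_combination w 0 * h1 + w 1 * h2
  by_cases hx0 : x 0 = 0
  · have hx1 : x 1 ≠ 0 := fun h => hx (by ext i; fin_cases i <;> simp [hx0, h])
    have hy1 : y 1 = 0 := by simpa [hx0, hx1] using key
    have hy0 : y 0 ≠ 0 := fun h => h0 (by ext i; fin_cases i <;> simp [hy1, h])
    refine ⟨![1, 0], fun h => by simpa using congrFun h 0, ?_⟩
    convert W.smul_mem (y 0)⁻¹ hw using 1
    ext i; fin_cases i <;> simp [hy1, hy0]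
  · have hx0' : algebraMap k K (x 0) ≠ 0 := by simpa using hx0
    have hy1 : y 1 ≠ 0 := fun h => h0 (by
      have : y 0 = 0 := by simpa [h, hx0] using key
      ext i; fin_cases i <;> simp [this, h])
    refine ⟨![x 1, -x 0], fun h => hx0 (by simpa using congrFun h 1), ?_⟩
    convert W.smul_mem (-(algebraMap k K (x 0)) * (y 1)⁻¹) hw using 1
    ext i; fin_cases i
    · simp
      field_simp
      linear_combination key
    · simp [hy1]

/-- If `k` is a field of characteristic `≠ 2`, `ρ : G → GL₂(k)` is an irreducible
representation, and there is `τ ∈ G` with `ρ(τ)² = 1` and `det ρ(τ) = -1`, then `ρ` is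
absolutely irreducible: the representation on `k̄²` obtained by extending scalars to an
algebraic closure is irreducible. -/
theorem absolutely_irreducible_of_irreducible
    {k : Type*} [Field k] (hk : ringChar k ≠ 2)
    {G : Type*} [Group G] (ρ : G →* GL (Fin 2) k)
    (hirr : ∀ W : Submodule k (Fin 2 → k),
      (∀ (g : G), ∀ v ∈ W, (ρ g : Matrix (Fin 2) (Fin 2) k).mulVec v ∈ W) →
      W = ⊥ ∨ W = ⊤)
    (τ : G) (hτ : ρ τ ^ 2 = 1)
    (hdet : (ρ τ : Matrix (Fin 2) (Fin 2) k).det = -1) :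
    ∀ W : Submodule (AlgebraicClosure k) (Fin 2 → AlgebraicClosure k),
      (∀ (g : G), ∀ v ∈ W,
        ((ρ g : Matrix (Fin 2) (Fin 2) k).map
          (algebraMap k (AlgebraicClosure k))).mulVec v ∈ W) →
      W = ⊥ ∨ W = ⊤ := by
  intro W hW
  set K := AlgebraicClosure k
  set A : Matrix (Fin 2) (Fin 2) k := (ρ τ : Matrix (Fin 2) (Fin 2) k) with hA
  have hA2 : A * A = 1 := by
    have := congrArg (fun g : GL (Fin 2) k => (g : Matrix (Fin 2) (Fin 2) k)) hτ
    simpa [pow_two] using this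
  have htr : A 0 0 + A 1 1 = 0 := by
    have e00 := congrFun (congrFun hA2 0) 0
    have e01 := congrFun (congrFun hA2 0) 1
    have e10 := congrFun (congrFun hA2 1) 0
    have e11 := congrFun (congrFun hA2 1) 1
    simp [Matrix.mul_apply, Fin.sum_univ_two] at e00 e01 e10 e11
    rw [Matrix.det_fin_two] at hdet
    have h1 : (A 0 0 + A 1 1) * A 0 0 = 0 := by linear_combination e00 + hdet
    have h2 : (A 0 0 + A 1 1) * A 1 1 = 0 := by linear_combination e11 + hdet
    have : (A 0 0 + A 1 1) * (A 0 0 + A 1 1) = 0 := by linear_combination h1 + h2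
    exact mul_self_eq_zero.1 this
  have hp : (1 + A).det = 0 := by
    rw [Matrix.det_fin_two] at hdet ⊢
    simp
    linear_combination hdet + htr
  have hm : (1 - A).det = 0 := by
    rw [Matrix.det_fin_two] at hdet ⊢
    simp
    linear_combination hdet - htr
  let W0 : Submodule k (Fin 2 → k) :=
    { carrier := {v | (fun i => algebraMap k K (v i)) ∈ W}
      zero_mem' := by
        have := W.zero_mem
        simp only [Set.mem_ofPred_eq]
        convert this using 1
        ext i; simp
      add_mem' := by
        intro a b ha hb
        simp only [Set.mem_ofPred_eq] at ha hb ⊢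
        convert W.add_mem ha hb using 1
        ext i; simp
      smul_mem' := by
        intro c a ha
        simp only [Set.mem_ofPred_eq] at ha ⊢
        convert W.smul_mem (algebraMap k K c) ha using 1
        ext i; simp }
  have hW0 : ∀ v, v ∈ W0 ↔ (fun i => algebraMap k K (v i)) ∈ W := fun v => Iff.rfl
  rcases hirr W0 (by
    intro g v hv
    rw [hW0] at hv ⊢
    convert hW g _ hv using 1
    ext i; simp [Matrix.mulVec, dotProduct]; rfl) with h | h
  · left
    rw [Submodule.eq_bot_iff]
    intro w hw
    by_contra hne
    have hAw := hW τ w hw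
    have e1 : ((1 + A).map (algebraMap k K)).mulVec w
        = w + (A.map (algebraMap k K)).mulVec w := by
      rw [Matrix.map_add _ (map_add _), Matrix.add_mulVec, Matrix.map_one _ (map_zero _) (map_one _),
        Matrix.one_mulVec]
    have e2 : ((1 - A).map (algebraMap k K)).mulVec w
        = w - (A.map (algebraMap k K)).mulVec w := by
      rw [Matrix.map_sub _ (map_sub _), Matrix.sub_mulVec, Matrix.map_one _ (map_zero _) (map_one _),
        Matrix.one_mulVec]
    have fin : ¬ ∃ u : Fin 2 → k, u ≠ 0 ∧ (fun i => algebraMap k K (u i)) ∈ W := by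
      rintro ⟨u, hu, huW⟩
      have : u ∈ W0 := huW
      rw [h] at this
      exact hu (by simpa using this)
    have z1 : w + (A.map (algebraMap k K)).mulVec w = 0 := by
      by_contra hz
      exact fin (exists_rational_vec (1 + A) hp W w (e1 ▸ W.add_mem hw hAw) (e1 ▸ hz))
    have z2 : w - (A.map (algebraMap k K)).mulVec w = 0 := by
      by_contra hz
      exact fin (exists_rational_vec (1 - A) hm W w (e2 ▸ W.sub_mem hw hAw) (e2 ▸ hz))
    have h2 : (2 : K) ≠ 0 := by
      have := (algebraMap k K).injective.ne (Ring.two_ne_zero hk)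
      simpa only [map_ofNat, map_zero] using this
    apply hne
    have : (2 : K) • w = 0 := by
      rw [two_smul]
      calc w + w = (w + (A.map (algebraMap k K)).mulVec w)
            + (w - (A.map (algebraMap k K)).mulVec w) := by abel
        _ = 0 := by rw [z1, z2, add_zero]
    exact (smul_eq_zero.1 this).resolve_left h2
  · right
    rw [Submodule.eq_top_iff']
    intro w
    have t : ∀ v : Fin 2 → k, (fun i => algebraMap k K (v i)) ∈ W := fun v => by
      rw [← hW0, h]; trivial
    convert W.add_mem (W.smul_mem (w 0) (t ![1, 0])) (W.smul_mem (w 1) (t ![0, 1])) using 1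
    ext i; fin_cases i <;> simp
end

section
/- The elliptic curve over ℚ defined by y² = x(x + 9)(x - 16) has exactly eight rational points (including the point at infinity). -/
namespace X015

lemma four_number {a b c d : ℤ} (h : a * b = c * d) (ha : a ≠ 0) :
    ∃ α β γ δ : ℤ, a = α * β ∧ b = γ * δ ∧ c = α * γ ∧ d = β * δ := by
  obtain ⟨α, β, ⟨γ, hγ⟩, ⟨δ, hδ⟩, hab⟩ := exists_dvd_and_dvd_of_dvd_mul (Dvd.intro b h)
  refine ⟨α, β, γ, δ, hab, ?_, hγ, hδ⟩
  apply mul_left_cancel₀ ha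
  rw [h, hγ, hδ, hab]; ring

lemma common_factor {β γ A B : ℤ} (hc : IsCoprime β γ) (hβ : β ≠ 0) (hA : 0 < A)
    (h : β ^ 2 * A = γ ^ 2 * B) : ∃ g : ℤ, 0 < g ∧ A = g * γ ^ 2 ∧ B = g * β ^ 2 := by
  have h1 : γ ^ 2 ∣ A := by
    have : IsCoprime (γ ^ 2) (β ^ 2) := (hc.symm).pow
    exact this.dvd_of_dvd_mul_left (Dvd.intro B h.symm)
  obtain ⟨g, hg⟩ := h1
  have hγ : γ ≠ 0 := by
    rintro rfl
    simp at hg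
    omega
  have hγ2 : 0 < γ ^ 2 := by positivity
  refine ⟨g, ?_, by rw [hg]; ring, ?_⟩
  · by_contra hn
    push Not at hn
    nlinarith
  · apply mul_left_cancel₀ hγ2.ne'
    rw [← h, hg]; ring

lemma dvd_nine {a b g : ℤ} (h : IsCoprime a b) (ha : g ∣ 9 * a ^ 2) (hb : g ∣ 9 * b ^ 2) :
    g ∣ 9 := by
  obtain ⟨u, v, huv⟩ := (h.pow : IsCoprime (a ^ 2) (b ^ 2))
  have h9 : (9 : ℤ) = u * (9 * a ^ 2) + v * (9 * b ^ 2) := by linear_combination (-9) * huv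
  rw [h9]
  exact dvd_add (Dvd.dvd.mul_left ha u) (Dvd.dvd.mul_left hb v)

lemma g_cases {g : ℤ} (hg : 0 < g) (h : g ∣ 9) : g = 1 ∨ g = 3 ∨ g = 9 := by
  have : g ≤ 9 := Int.le_of_dvd (by norm_num) h
  interval_cases g <;> omega

lemma three_not_dvd {a b : ℤ} (h : IsCoprime a b) : ¬ (3 : ℤ) ∣ a ^ 2 + b ^ 2 := by
  intro h3
  have key : (3 : ℤ) ∣ a ∧ (3 : ℤ) ∣ b := by
    have ha : a % 3 = 0 ∨ a % 3 = 1 ∨ a % 3 = 2 := by omega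
    have hb : b % 3 = 0 ∨ b % 3 = 1 ∨ b % 3 = 2 := by omega
    have h3' := Int.emod_eq_zero_of_dvd h3
    rcases ha with ha | ha | ha <;> rcases hb with hb | hb | hb <;>
      simp [pow_two, Int.add_emod, Int.mul_emod, ha, hb] at h3' <;> omega
  have := h.isUnit_of_dvd' key.1 key.2
  exact absurd (Int.isUnit_iff.mp this) (by norm_num)

lemma odd_sq_mod {a : ℤ} (h : a % 2 = 1) : a ^ 2 % 8 = 1 := by
  have ha : a % 8 = 1 ∨ a % 8 = 3 ∨ a % 8 = 5 ∨ a % 8 = 7 := by omega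
  rcases ha with ha | ha | ha | ha <;> simp [pow_two, Int.mul_emod, ha]

/-- Core of the impossible case. -/
lemma core2 {r s p q : ℤ} (hrs : IsCoprime r s) (hr : r ≠ 0) (hs : s % 2 = 1)
    (h : r * s = p * q) (h2 : 16 * r ^ 2 - s ^ 2 = 5 * (p ^ 2 - q ^ 2)) : False := by
  obtain ⟨α, β, γ, δ, rfl, rfl, rfl, rfl⟩ := four_number h hr
  have hβγ : IsCoprime β γ := hrs.of_mul_left_right.of_mul_right_left
  have hαδ : IsCoprime α δ := hrs.of_mul_left_left.of_mul_right_right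
  have hβ : β ≠ 0 := right_ne_zero_of_mul hr
  have hα : α ≠ 0 := left_ne_zero_of_mul hr
  obtain ⟨g, hg, hA, hB⟩ := common_factor (A := 16 * α ^ 2 + 5 * δ ^ 2)
    (B := 5 * α ^ 2 + δ ^ 2) hβγ hβ (by positivity) (by linear_combination h2)
  have h9 : g ∣ 9 := dvd_nine hαδ ⟨5 * β ^ 2 - γ ^ 2, by linear_combination 5 * hB - hA⟩
    ⟨5 * γ ^ 2 - 16 * β ^ 2, by linear_combination 5 * hA - 16 * hB⟩
  have hodd := Int.odd_mul.mp (Int.odd_iff.mpr hs)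
  have e1 := odd_sq_mod (Int.odd_iff.mp hodd.1)
  have e2 := odd_sq_mod (Int.odd_iff.mp hodd.2)
  rcases g_cases hg h9 with rfl | rfl | rfl <;> omega

lemma four_dvd {p q f : ℤ} (h : p * q = 4 * f)
    (hpar : p % 2 = 0 ∧ q % 2 = 1 ∨ p % 2 = 1 ∧ q % 2 = 0) :
    (∃ p', p = 4 * p' ∧ q % 2 = 1) ∨ (∃ q', q = 4 * q' ∧ p % 2 = 1) := by
  rcases hpar with ⟨h1, h2⟩ | ⟨h1, h2⟩
  · left
    have hc : IsCoprime (4 : ℤ) q := by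
      have : IsCoprime (2 : ℤ) q := by
        rw [Int.isCoprime_iff_gcd_eq_one]
        exact Int.isCoprime_iff_gcd_eq_one.mp (Int.isCoprime_two_left.mpr (Int.odd_iff.mpr h2))
      have h' := this.pow_left (m := 2)
      norm_num at h'
      exact h'
    obtain ⟨p', hp'⟩ := hc.dvd_of_dvd_mul_right (Dvd.intro f h.symm)
    exact ⟨p', hp', h2⟩
  · right
    have hc : IsCoprime (4 : ℤ) p := by
      have : IsCoprime (2 : ℤ) p := Int.isCoprime_two_left.mpr (Int.odd_iff.mpr h1)
      have h' := this.pow_left (m := 2)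
      norm_num at h'
      exact h'
    obtain ⟨q', hq'⟩ := hc.dvd_of_dvd_mul_left (Dvd.intro f h.symm)
    exact ⟨q', hq', h1⟩

lemma prime5 : Prime (5 : ℤ) := by norm_num

lemma coprime5 {a : ℤ} (h : ¬ (5 : ℤ) ∣ a) : IsCoprime a 5 :=
  ((prime5.coprime_iff_not_dvd).mpr h).symm

lemma coprime4 {a : ℤ} (h : a % 2 = 1) : IsCoprime a 4 := by
  have : IsCoprime (2 : ℤ) a := Int.isCoprime_two_left.mpr (Int.odd_iff.mpr h)
  have h' := this.pow_left (m := 2)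
  norm_num at h'
  exact h'.symm

/-- Parametrization of a primitive triple with odd first leg. -/
lemma triple {x y z : ℤ} (h : x ^ 2 + y ^ 2 = z ^ 2) (hx : x % 2 = 1) (hc : IsCoprime x y) :
    ∃ p q : ℤ, x = p ^ 2 - q ^ 2 ∧ y = 2 * p * q ∧ IsCoprime p q ∧
      (p % 2 = 0 ∧ q % 2 = 1 ∨ p % 2 = 1 ∧ q % 2 = 0) := by
  have hz : 0 < |z| := by
    rw [abs_pos]
    rintro rfl
    have : x ≠ 0 := by rintro rfl; norm_num at hx
    have : 0 < x ^ 2 := by positivity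
    nlinarith [sq_nonneg y]
  have ht : PythagoreanTriple x y |z| := by
    unfold PythagoreanTriple
    rw [abs_mul_abs_self]
    linear_combination h
  obtain ⟨m, n, h1, h2, -, h4, h5, -⟩ :=
    ht.coprime_classification' (Int.isCoprime_iff_gcd_eq_one.mp hc) hx hz
  exact ⟨m, n, h1, h2, Int.isCoprime_iff_gcd_eq_one.mpr h4, h5⟩

lemma case2 {m e c d : ℤ} (he : e % 2 = 1) (hm : ¬ (5 : ℤ) ∣ m) (hc : IsCoprime m e)
    (h1 : m ^ 2 + e ^ 2 = c ^ 2) (h2 : 16 * m ^ 2 + 25 * e ^ 2 = d ^ 2) : False := by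
  have hm0 : m ≠ 0 := by rintro rfl; simp at hm
  obtain ⟨p, q, a1, a2, a3, a4⟩ := triple (x := e) (y := m) (z := c) (by linarith) he hc.symm
  have hc5 : IsCoprime (5 * e) (4 * m) := by
    refine IsCoprime.mul_left ?_ ?_
    · exact IsCoprime.mul_right (by norm_num) (coprime5 hm).symm
    · exact IsCoprime.mul_right (coprime4 he) hc.symm
  obtain ⟨r, s, b1, b2, b3, b4⟩ := triple (x := 5 * e) (y := 4 * m) (z := d)
    (by linarith) (by omega) hc5
  have hrs : r * s = 4 * (p * q) := by linarith
  rcases four_dvd hrs b4 with ⟨r', rfl, hs⟩ | ⟨s', rfl, hr⟩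
  · refine core2 (r := r') (s := s) (p := p) (q := q) b3.of_mul_left_right ?_ hs (by linarith)
      (by linear_combination 5 * a1 - b1)
    rintro rfl
    apply hm0; linarith
  · refine core2 (r := s') (s := r) (p := q) (q := p) b3.of_mul_right_right.symm ?_ hr
      (by linarith) (by linear_combination b1 - 5 * a1)
    rintro rfl
    apply hm0; linarith

lemma core1 {p q r s f : ℤ} (hpq : IsCoprime p q) (hrs : IsCoprime r s) (hf : f ≠ 0)
    (hq : q % 2 = 1) (h1 : p * q = f) (h2 : r * s = 5 * f)
    (h3 : 16 * p ^ 2 - q ^ 2 = r ^ 2 - s ^ 2) :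
    ∃ α δ β γ : ℤ, δ % 2 = 1 ∧ ¬ (5 : ℤ) ∣ δ ∧ IsCoprime δ α ∧ δ ^ 2 + 16 * α ^ 2 = γ ^ 2 ∧
      δ ^ 2 + 25 * α ^ 2 = β ^ 2 ∧ α ≠ 0 ∧ α ∣ f := by
  have hp0 : p ≠ 0 := by rintro rfl; apply hf; linarith
  have not5 : ∀ {a b : ℤ}, IsCoprime a b → (5 : ℤ) ∣ a → ¬ (5 : ℤ) ∣ b := by
    intro a b hab ha hb
    exact prime5.not_isUnit (hab.isUnit_of_dvd' ha hb)
  rcases prime5.dvd_or_dvd (Dvd.intro f h2.symm) with h5 | h5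
  · have hs5 : ¬ (5 : ℤ) ∣ s := not5 hrs h5
    obtain ⟨r', rfl⟩ := h5
    obtain ⟨α, β, γ, δ, rfl, rfl, rfl, rfl⟩ :=
      four_number (a := p) (b := q) (c := r') (d := s) (by linarith) hp0
    have hβγ : IsCoprime β γ := hpq.of_mul_left_right.of_mul_right_left
    have hαδ : IsCoprime α δ := hpq.of_mul_left_left.of_mul_right_right
    have hβ : β ≠ 0 := right_ne_zero_of_mul hp0
    have hα : α ≠ 0 := left_ne_zero_of_mul hp0
    obtain ⟨g, hg, hA, hB⟩ := common_factor (A := 16 * α ^ 2 + δ ^ 2)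
      (B := 25 * α ^ 2 + δ ^ 2) hβγ hβ (by positivity) (by linear_combination h3)
    have h9 : g ∣ 9 := dvd_nine hαδ ⟨β ^ 2 - γ ^ 2, by linear_combination hB - hA⟩
      ⟨25 * γ ^ 2 - 16 * β ^ 2, by linear_combination 25 * hA - 16 * hB⟩
    have h33 := three_not_dvd hαδ
    have hodd := Int.odd_mul.mp (Int.odd_iff.mpr hq)
    have g1 : g = 1 := by
      rcases g_cases hg h9 with rfl | rfl | rfl
      · rfl
      · omega
      · omega
    subst g1
    exact ⟨α, δ, β, γ, Int.odd_iff.mp hodd.2, fun h => hs5 (Dvd.dvd.mul_left h β), hαδ.symm,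
      by linarith, by linarith, hα, ⟨β * (γ * δ), by rw [← h1]; ring⟩⟩
  · exfalso
    have hr5 : ¬ (5 : ℤ) ∣ r := not5 hrs.symm h5
    obtain ⟨s', rfl⟩ := h5
    obtain ⟨α, β, γ, δ, rfl, rfl, rfl, rfl⟩ :=
      four_number (a := p) (b := q) (c := r) (d := s') (by linarith) hp0
    have hβγ : IsCoprime β γ := hpq.of_mul_left_right.of_mul_right_left
    have hαδ : IsCoprime α δ := hpq.of_mul_left_left.of_mul_right_right
    have hβ : β ≠ 0 := right_ne_zero_of_mul hp0
    have hα : α ≠ 0 := left_ne_zero_of_mul hp0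
    obtain ⟨g, hg, hA, hB⟩ := common_factor (A := 16 * α ^ 2 + 25 * δ ^ 2)
      (B := α ^ 2 + δ ^ 2) hβγ hβ (by positivity) (by linear_combination h3)
    have h9 : g ∣ 9 := dvd_nine hαδ ⟨25 * β ^ 2 - γ ^ 2, by linear_combination 25 * hB - hA⟩
      ⟨γ ^ 2 - 16 * β ^ 2, by linear_combination hA - 16 * hB⟩
    have h33 := three_not_dvd hαδ
    have hodd := Int.odd_mul.mp (Int.odd_iff.mpr hq)
    have g1 : g = 1 := by
      rcases g_cases hg h9 with rfl | rfl | rfl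
      · rfl
      · omega
      · omega
    subst g1
    exact case2 (m := α) (e := δ) (c := β) (d := γ) (Int.odd_iff.mp hodd.2)
      (fun h => hr5 (Dvd.dvd.mul_right h γ)) hαδ (by linarith) (by linarith)

lemma case1 (n : ℕ) : ∀ {M e c d : ℤ}, e.natAbs = n → M % 2 = 1 → ¬ (5 : ℤ) ∣ M →
    IsCoprime M e → M ^ 2 + 16 * e ^ 2 = c ^ 2 → M ^ 2 + 25 * e ^ 2 = d ^ 2 → e = 0 := by
  induction n using Nat.strong_induction_on with
  | _ n ih =>
    intro M e c d hn hM hM5 hc h1 h2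
    by_contra he
    obtain ⟨p, q, a1, a2, a3, a4⟩ := triple (x := M) (y := 4 * e) (z := c) (by linarith) hM
      (IsCoprime.mul_right (coprime4 hM) hc)
    obtain ⟨r, s, b1, b2, b3, b4⟩ := triple (x := M) (y := 5 * e) (z := d) (by linarith) hM
      (IsCoprime.mul_right (coprime5 hM5) hc)
    have he2 : ∃ f, e = 2 * f := by
      have : 5 * e = 2 * (r * s) := by linarith
      exact ⟨r * s - 2 * e, by linarith⟩
    obtain ⟨f, rfl⟩ := he2
    have hf : f ≠ 0 := by rintro rfl; simp at he
    have key : ∃ α δ β γ : ℤ, δ % 2 = 1 ∧ ¬ (5 : ℤ) ∣ δ ∧ IsCoprime δ α ∧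
        δ ^ 2 + 16 * α ^ 2 = γ ^ 2 ∧ δ ^ 2 + 25 * α ^ 2 = β ^ 2 ∧ α ≠ 0 ∧ α ∣ f := by
      have hpq : p * q = 4 * f := by linarith
      rcases four_dvd hpq a4 with ⟨p', rfl, hq⟩ | ⟨q', rfl, hp⟩
      · exact core1 (p := p') (q := q) (r := r) (s := s) a3.of_mul_left_right b3 hf hq
          (by linarith) (by linarith) (by linear_combination b1 - a1)
      · exact core1 (p := q') (q := p) (r := s) (s := r) a3.of_mul_right_right.symm b3.symm hf hp
          (by linarith) (by linarith) (by linear_combination a1 - b1)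
    obtain ⟨α, δ, β, γ, k1, k2, k3, k4, k5, k6, k7⟩ := key
    have hle : α.natAbs ≤ f.natAbs :=
      Nat.le_of_dvd (Int.natAbs_pos.mpr hf) (Int.natAbs_dvd_natAbs.mpr k7)
    exact k6 (ih α.natAbs (by omega) rfl k1 k2 k3 k4 k5)

lemma int_main {M e c d : ℤ} (he : e ≠ 0) (hc : IsCoprime M e)
    (h1 : M ^ 2 + 16 * e ^ 2 = c ^ 2) (h2 : M ^ 2 + 25 * e ^ 2 = d ^ 2) : M = 0 := by
  have root : ∀ {k x z : ℤ}, k ≠ 0 → k ^ 2 * x = z ^ 2 → ∃ w, x = w ^ 2 := by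
    intro k x z hk h
    obtain ⟨w, rfl⟩ := (Int.pow_dvd_pow_iff (two_ne_zero)).mp (Dvd.intro x h)
    refine ⟨w, mul_left_cancel₀ (pow_ne_zero 2 hk) ?_⟩
    rw [h]; ring
  have notboth : ∀ {k : ℤ}, Prime k → k ∣ M → ¬ k ∣ e := fun hk ha hb =>
    hk.not_isUnit (hc.isUnit_of_dvd' ha hb)
  by_cases h5 : (5 : ℤ) ∣ M
  · have he5 := notboth prime5 h5
    obtain ⟨m, rfl⟩ := h5
    obtain ⟨d', hd⟩ := root (k := 5) (x := m ^ 2 + e ^ 2) (z := d) (by norm_num) (by linarith)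
    rcases Int.emod_two_eq_zero_or_one m with hm | hm
    · have he2 : e % 2 = 1 := by
        by_contra h
        exact notboth (k := 2) Int.prime_two (by omega) (by omega)
      have h4 : ∃ k, m = 4 * k := by
        have e1 := odd_sq_mod he2
        obtain ⟨k, rfl⟩ : ∃ k, m = 2 * k := ⟨m / 2, by omega⟩
        have hd2 : d' % 2 = 1 := by
          by_contra h
          obtain ⟨l, rfl⟩ : ∃ l, d' = 2 * l := ⟨d' / 2, by omega⟩
          have : 4 * k ^ 2 + e ^ 2 = 4 * l ^ 2 := by linarith
          omega
        have e2 := odd_sq_mod hd2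
        have e3 : k % 2 = 0 := by
          by_contra h
          have := odd_sq_mod (a := k) (by omega)
          have : 4 * k ^ 2 + e ^ 2 = d' ^ 2 := by linarith
          omega
        exact ⟨k / 2, by omega⟩
      obtain ⟨k, rfl⟩ := h4
      obtain ⟨c', hc'⟩ := root (k := 4) (x := e ^ 2 + 25 * k ^ 2) (z := c) (by norm_num)
        (by linarith)
      have hk := case1 k.natAbs (M := e) (e := k) (c := d') (d := c') rfl he2 he5
        hc.of_mul_left_right.of_mul_left_right.symm (by linarith) (by linarith)
      rw [hk]; norm_num
    · exfalso
      exact case2 (m := e) (e := m) (c := d') (d := c) hm he5 hc.of_mul_left_right.symm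
        (by linarith) (by linarith)
  · exfalso
    rcases Int.emod_two_eq_zero_or_one M with hm | hm
    · have he2 : e % 2 = 1 := by
        by_contra h
        exact notboth (k := 2) Int.prime_two (by omega) (by omega)
      have h4 : ∃ k, M = 4 * k := by
        have e1 := odd_sq_mod he2
        obtain ⟨k, rfl⟩ : ∃ k, M = 2 * k := ⟨M / 2, by omega⟩
        have hd2 : d % 2 = 1 := by
          by_contra h
          obtain ⟨l, rfl⟩ : ∃ l, d = 2 * l := ⟨d / 2, by omega⟩
          have : 4 * k ^ 2 + 25 * e ^ 2 = 4 * l ^ 2 := by linarith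
          omega
        have e2 := odd_sq_mod hd2
        have e3 : k % 2 = 0 := by
          by_contra h
          have := odd_sq_mod (a := k) (by omega)
          have : 4 * k ^ 2 + 25 * e ^ 2 = d ^ 2 := by linarith
          omega
        exact ⟨k / 2, by omega⟩
      obtain ⟨k, rfl⟩ := h4
      obtain ⟨c', hc'⟩ := root (k := 4) (x := k ^ 2 + e ^ 2) (z := c) (by norm_num) (by linarith)
      exact case2 (m := k) (e := e) (c := c') (d := d) he2
        (fun h => h5 (Dvd.dvd.mul_left h 4)) hc.of_mul_left_right (by linarith) (by linarith)
    · exact he (case1 e.natAbs rfl hm h5 hc h1 h2)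

lemma rat_main {u v w : ℚ} (h1 : u ^ 2 + 16 = v ^ 2) (h2 : u ^ 2 + 25 = w ^ 2) : u = 0 := by
  have hden : (u.den : ℚ) ≠ 0 := by exact_mod_cast u.den_nz
  have hu : u * u.den = u.num := Rat.mul_den_eq_num u
  have intsq : ∀ {n : ℤ} {t : ℚ}, (n : ℚ) = t ^ 2 → ∃ c : ℤ, n = c ^ 2 := by
    intro n t h
    have : IsSquare (n : ℚ) := ⟨t, by rw [h]; ring⟩
    rw [Rat.isSquare_intCast_iff] at this
    obtain ⟨c, hc⟩ := this
    exact ⟨c, by rw [hc]; ring⟩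
  obtain ⟨c, hc⟩ := intsq (n := u.num ^ 2 + 16 * (u.den : ℤ) ^ 2) (t := v * u.den) (by
    push_cast
    rw [← hu]
    linear_combination (u.den : ℚ) ^ 2 * h1)
  obtain ⟨d, hd⟩ := intsq (n := u.num ^ 2 + 25 * (u.den : ℤ) ^ 2) (t := w * u.den) (by
    push_cast
    rw [← hu]
    linear_combination (u.den : ℚ) ^ 2 * h2)
  have := int_main (M := u.num) (e := u.den) (by exact_mod_cast u.den_nz)
    (Rat.isCoprime_num_den u) hc hd
  exact Rat.num_eq_zero.mp this

lemma affine_points {x y : ℚ} (h : y ^ 2 = x * (x + 9) * (x - 16)) :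
    (x = 0 ∧ y = 0) ∨ (x = -9 ∧ y = 0) ∨ (x = 16 ∧ y = 0) ∨ (x = 36 ∧ y = 180) ∨
    (x = 36 ∧ y = -180) ∨ (x = -4 ∧ y = 20) ∨ (x = -4 ∧ y = -20) := by
  by_cases hy : y = 0
  · subst hy
    have h' : x * (x + 9) * (x - 16) = 0 := by rw [← h]; ring
    rcases mul_eq_zero.mp h' with h' | h'
    · rcases mul_eq_zero.mp h' with h' | h'
      · simp [h']
      · right; left; exact ⟨by linarith, rfl⟩
    · right; right; left; exact ⟨by linarith, rfl⟩
  · obtain ⟨X, rfl⟩ : ∃ X, x = X + 16 := ⟨x - 16, by ring⟩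
    have h0 := rat_main (u := (X ^ 2 - 400) / (2 * y)) (v := (X ^ 2 + 32 * X + 400) / (2 * y))
      (w := (X ^ 2 + 50 * X + 400) / (2 * y))
      (by field_simp; linear_combination 64 * h) (by field_simp; linear_combination 100 * h)
    have h1 : X ^ 2 - 400 = 0 := by
      rcases div_eq_zero_iff.mp h0 with h0 | h0
      · exact h0
      · exfalso; apply hy; linarith
    have h2 : (X - 20) * (X + 20) = 0 := by linear_combination h1
    rcases mul_eq_zero.mp h2 with h3 | h3
    · have hX : X = 20 := by linarith
      subst hX
      have : (y - 180) * (y + 180) = 0 := by linear_combination h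
      rcases mul_eq_zero.mp this with h4 | h4
      · right; right; right; left; exact ⟨by norm_num, by linarith⟩
      · right; right; right; right; left; exact ⟨by norm_num, by linarith⟩
    · have hX : X = -20 := by linarith
      subst hX
      have : (y - 20) * (y + 20) = 0 := by linear_combination h
      rcases mul_eq_zero.mp this with h4 | h4
      · right; right; right; right; right; left; exact ⟨by norm_num, by linarith⟩
      · right; right; right; right; right; right; exact ⟨by norm_num, by linarith⟩

/-- The coordinates of a point, `none` for the point at infinity. -/
def coords : (⟨0, -7, 0, -144, 0⟩ : WeierstrassCurve ℚ).toAffine.Point → Option (ℚ × ℚ)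
  | .zero => none
  | .some x y _ => some (x, y)

lemma coords_injective : Function.Injective coords := by
  intro P Q h
  cases P <;> cases Q <;> simp_all [coords]

/-- The eight points. -/
def pts : Finset (Option (ℚ × ℚ)) :=
  {none, some (0, 0), some (-9, 0), some (16, 0), some (36, 180), some (36, -180),
    some (-4, 20), some (-4, -20)}

lemma range_coords : Set.range coords = (pts : Set (Option (ℚ × ℚ))) := by
  ext t
  constructor
  · rintro ⟨P, rfl⟩
    cases P with
    | zero => simp [coords, pts]
    | some x y h =>
      have he := h.1
      rw [WeierstrassCurve.Affine.equation_iff] at he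
      have := affine_points (x := x) (y := y) (by linear_combination he)
      rcases this with h | h | h | h | h | h | h <;> simp [coords, pts, h.1, h.2]
  · intro ht
    cases t with
    | none => exact ⟨.zero, rfl⟩
    | some z =>
      obtain ⟨x, y⟩ := z
      have hns : (⟨0, -7, 0, -144, 0⟩ : WeierstrassCurve ℚ).toAffine.Nonsingular x y := by
        rw [WeierstrassCurve.Affine.nonsingular_iff, WeierstrassCurve.Affine.equation_iff]
        simp [pts] at ht
        rcases ht with h | h | h | h | h | h | h <;> obtain ⟨rfl, rfl⟩ := h <;> norm_num
      exact ⟨.some x y hns, rfl⟩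

end X015

/-- The elliptic curve `y² = x(x + 9)(x - 16)` over `ℚ` (an equation for `X₀(15)`) has
exactly eight rational points, including the point at infinity. -/
theorem X0_15_has_eight_rational_points :
    Nat.card (⟨0, -7, 0, -144, 0⟩ : WeierstrassCurve ℚ).toAffine.Point = 8 := by
  rw [← Nat.card_range_of_injective X015.coords_injective, X015.range_coords]
  rw [Nat.card_coe_set_eq, Set.ncard_coe_finset]
  unfold X015.pts
  repeat rw [Finset.card_insert_of_notMem (by simp <;> norm_num)]
  rw [Finset.card_singleton]
end

section
/- Let A be a commutative ring, let A[ε] = A[x]/(x²) be the ring of dual numbers over A with reduction map π : A[ε] → A (sending ε to 0), let G be a group, and let ρ, ρ₀ : G → GL₂(A[ε]) be group homomorphisms whose compositions with the induced map GL₂(A[ε]) → GL₂(A) are equal; call the common composition ρ̄. Then for each g ∈ G there is a unique matrix c(g) ∈ M₂(A) with ρ(g)·ρ₀(g)⁻¹ = 1 + ε·c(g), and the function c : G → M₂(A) is a 1-cocycle for the adjoint action of G on M₂(A): c(gh) = c(g) + ρ̄(g)·c(h)·ρ̄(g)⁻¹ for all g, h ∈ G. -/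
open Matrix TrivSqZeroExt

section helpers
variable {A : Type*} [CommRing A]

lemma ldc_fst_mul (M N : Matrix (Fin 2) (Fin 2) (DualNumber A)) :
    (M * N).map fst = M.map fst * N.map fst := by
  ext i j
  simp [Matrix.mul_apply, Fin.sum_univ_two]

lemma ldc_snd_mul (M N : Matrix (Fin 2) (Fin 2) (DualNumber A)) :
    (M * N).map snd = M.map fst * N.map snd + M.map snd * N.map fst := by
  ext i j
  simp [Matrix.mul_apply, Fin.sum_univ_two]
  ring

lemma ldc_fst (c : Matrix (Fin 2) (Fin 2) A) :
    ((1 + (DualNumber.eps : DualNumber A) • (c.map (inl : A → DualNumber A)) :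
      Matrix (Fin 2) (Fin 2) (DualNumber A))).map fst = 1 := by
  ext i j
  by_cases h : i = j <;> simp [Matrix.one_apply, h]

lemma ldc_snd (c : Matrix (Fin 2) (Fin 2) A) :
    ((1 + (DualNumber.eps : DualNumber A) • (c.map (inl : A → DualNumber A)) :
      Matrix (Fin 2) (Fin 2) (DualNumber A))).map snd = c := by
  ext i j
  by_cases h : i = j <;> simp [Matrix.one_apply, h]

lemma ldc_ext {M N : Matrix (Fin 2) (Fin 2) (DualNumber A)}
    (h1 : M.map fst = N.map fst) (h2 : M.map snd = N.map snd) : M = N := by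
  ext i j
  · exact congrFun (congrFun h1 i) j
  · exact congrFun (congrFun h2 i) j

end helpers

/-- If `ρ, ρ₀ : G → GL₂(A[ε])` are homomorphisms agreeing after reduction `ε ↦ 0` to a
common homomorphism `ρ̄ : G → GL₂(A)`, then for each `g` there is a unique matrix
`c(g) ∈ M₂(A)` with `ρ(g)ρ₀(g)⁻¹ = 1 + ε·c(g)`, and any such function `c` is a
1-cocycle for the adjoint action: `c(gh) = c(g) + ρ̄(g)c(h)ρ̄(g)⁻¹`. -/
theorem lifting_difference_cocycle
    {A : Type*} [CommRing A] {G : Type*} [Group G]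
    (ρ ρ₀ : G →* GL (Fin 2) (DualNumber A)) (ρbar : G →* GL (Fin 2) A)
    (hρ : ∀ g : G, ((ρ g : Matrix (Fin 2) (Fin 2) (DualNumber A)).map fst) =
      (ρbar g : Matrix (Fin 2) (Fin 2) A))
    (hρ₀ : ∀ g : G, ((ρ₀ g : Matrix (Fin 2) (Fin 2) (DualNumber A)).map fst) =
      (ρbar g : Matrix (Fin 2) (Fin 2) A)) :
    (∀ g : G, ∃! c : Matrix (Fin 2) (Fin 2) A,
      ((ρ g * (ρ₀ g)⁻¹ : GL (Fin 2) (DualNumber A)) :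
          Matrix (Fin 2) (Fin 2) (DualNumber A)) =
        1 + (DualNumber.eps : DualNumber A) • (c.map (inl : A → DualNumber A))) ∧
    (∀ c : G → Matrix (Fin 2) (Fin 2) A,
      (∀ g : G, ((ρ g * (ρ₀ g)⁻¹ : GL (Fin 2) (DualNumber A)) :
          Matrix (Fin 2) (Fin 2) (DualNumber A)) =
        1 + (DualNumber.eps : DualNumber A) • ((c g).map (inl : A → DualNumber A))) →
      ∀ g h : G, c (g * h) =
        c g + (ρbar g : Matrix (Fin 2) (Fin 2) A) * c h *
          (((ρbar g)⁻¹ : GL (Fin 2) A) : Matrix (Fin 2) (Fin 2) A)) := by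
  constructor
  · intro g
    have hD : ((ρ g * (ρ₀ g)⁻¹ : GL (Fin 2) (DualNumber A)) :
        Matrix (Fin 2) (Fin 2) (DualNumber A)).map fst = 1 := by
      have e : ((ρ g * (ρ₀ g)⁻¹ : GL (Fin 2) (DualNumber A)) :
          Matrix (Fin 2) (Fin 2) (DualNumber A)) * (ρ₀ g).val = (ρ g).val := by
        rw [← Units.val_mul, inv_mul_cancel_right]
      have e2 := congrArg (fun M => M.map fst) e
      simp only [ldc_fst_mul _ (ρ₀ g).val, hρ, hρ₀] at e2
      exact (Units.mul_left_inj (ρbar g)).1 (e2.trans (one_mul _).symm)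
    refine ⟨((ρ g * (ρ₀ g)⁻¹ : GL (Fin 2) (DualNumber A)) :
        Matrix (Fin 2) (Fin 2) (DualNumber A)).map snd, ?_, ?_⟩
    · exact ldc_ext (by rw [ldc_fst, hD]) (by rw [ldc_snd])
    · intro c hc
      rw [hc, ldc_snd]
  · intro c hc g h
    have e : (ρ (g * h) * (ρ₀ (g * h))⁻¹) * ρ₀ g =
        ((ρ g * (ρ₀ g)⁻¹) * ρ₀ g) * (ρ h * (ρ₀ h)⁻¹) := by
      simp only [map_mul]; group
    have e2 := congrArg (fun u => u.val.map snd) e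
    simp only [Units.val_mul (ρ (g * h) * (ρ₀ (g * h))⁻¹), Units.val_mul (_ * ρ₀ g),
      Units.val_mul (ρ g * (ρ₀ g)⁻¹), hc, ldc_snd_mul, ldc_fst_mul, ldc_fst, ldc_snd, hρ₀,
      one_mul, mul_one] at e2
    have e3 : c (g * h) * (ρbar g).val = c g * (ρbar g).val + (ρbar g).val * c h := by
      apply add_left_cancel (a := (ρ₀ g).val.map snd)
      rw [e2]; abel
    have e4 := congrArg (fun M => M * ((ρbar g)⁻¹).val) e3
    simpa only [add_mul, Units.mul_inv_cancel_right] using e4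
end
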